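/- arXiv:math/0304047 — 3 statements merged into one kernel-verified Lean document; each statement's English description precedes it below -/
import Mathlib

section
/- Let q be a prime power and n ≥ 1. Then #{g ∈ GL(2n+1,F_q) : the characteristic polynomial of g·g^τ is squarefree} · |Sp(2n,F_q)| = #{s ∈ Sp(2n,F_q) : the characteristic polynomial of s is squarefree} · |GL(2n+1,F_q)|; that is, the proportion of g ∈ GL(2n+1,F_q) such that g·g^τ is regular semisimple equals the proportion of regular semisimple elements of Sp(2n,F_q). -/
open Matrix Polynomial

/-- The inverse-transpose automorphism of `GL(n,F)`: `g ↦ (gᵀ)⁻¹`. -/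
noncomputable def tau {n : ℕ} {F : Type} [Field F] (g : GL (Fin n) F) : GL (Fin n) F where
  val := (g⁻¹).val.transpose
  inv := g.val.transpose
  val_inv := by
    rw [← Matrix.transpose_mul, ← Units.val_mul, mul_inv_cancel, Units.val_one,
      Matrix.transpose_one]
  inv_val := by
    rw [← Matrix.transpose_mul, ← Units.val_mul, inv_mul_cancel, Units.val_one,
      Matrix.transpose_one]

/-- A polynomial of odd degree that is anti-invariant under reversal vanishes at `1`. -/
lemma eval_one_eq_zero_of_reverse_eq_neg {F : Type*} [Field F] {r : F[X]}
    (h : r.reverse = -r) (hodd : Odd r.natDegree) : r.eval 1 = 0 := by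
  have hc : ∀ k ≤ r.natDegree, r.coeff (r.natDegree - k) = -r.coeff k := by
    intro k hk
    rw [← revAt_le hk, ← coeff_reverse, h, coeff_neg]
  rw [eval_eq_sum_range]
  simp only [one_pow, mul_one]
  refine Finset.sum_involution (fun k _ => r.natDegree - k) ?_ ?_ ?_ ?_
  · intro k hk
    rw [hc k (by simpa [Nat.lt_succ_iff] using hk), add_neg_cancel]
  · intro k hk _ heq
    obtain ⟨m, hm⟩ := hodd
    have := Finset.mem_range.1 hk
    omega
  · intro k hk
    have := Finset.mem_range.1 hk
    exact Finset.mem_range.2 (by omega)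
  · intro k hk
    have := Finset.mem_range.1 hk
    omega

/-- A squarefree palindromic polynomial of even degree does not vanish at `1`. -/
lemma eval_one_ne_zero_of_reverse_eq_self {F : Type*} [Field F] {p : F[X]}
    (h : p.reverse = p) (heven : Even p.natDegree) (hp : Squarefree p) : p.eval 1 ≠ 0 := by
  intro h1
  obtain ⟨r, hr⟩ := dvd_iff_isRoot.2 h1
  have hp0 : p ≠ 0 := hp.ne_zero
  have hr0 : r ≠ 0 := by
    rintro rfl
    exact hp0 (by simpa using hr)
  have hX : (X - C (1 : F)) ≠ 0 := X_sub_C_ne_zero 1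
  have hrev : (X - C (1 : F)).reverse = -(X - C 1) := by
    ext k
    rw [coeff_reverse, natDegree_X_sub_C]
    rcases k with _ | _ | k
    · rw [revAt_le (by omega)]; simp [coeff_one]
    · rw [revAt_le (by omega)]; simp [coeff_one]
    · rw [revAt_eq_self_of_lt (by omega)]
      simp [coeff_X, coeff_one]
  have hrr : r.reverse = -r := by
    have : -(X - C (1 : F)) * r.reverse = (X - C 1) * r := by
      rw [← hrev, ← reverse_mul_of_domain, ← hr, h]
    refine mul_left_cancel₀ hX ?_
    rw [mul_neg, ← this, neg_mul, neg_neg]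
  have hdeg : p.natDegree = 1 + r.natDegree := by
    rw [hr, natDegree_mul hX hr0, natDegree_X_sub_C]
  have hodd : Odd r.natDegree := by
    rw [← Nat.not_even_iff_odd]
    intro he
    rw [hdeg] at heven
    exact (Nat.not_even_iff_odd.2 (he.one_add)) heven
  obtain ⟨t, ht⟩ := dvd_iff_isRoot.2 (eval_one_eq_zero_of_reverse_eq_neg hrr hodd)
  have := hp (X - C 1) ⟨t, by rw [hr]; nth_rw 1 [ht]; ring⟩
  exact not_isUnit_X_sub_C 1 this

/-- If `M` has determinant one and the same characteristic polynomial as `M⁻¹`, then the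
characteristic polynomial of `M` is palindromic up to the sign given by the dimension. -/
lemma reverse_charpoly_of_charpoly_inv_eq {F m : Type*} [Field F] [Fintype m] [DecidableEq m]
    {M : Matrix m m F} (hdet : M.det = 1) (h : M⁻¹.charpoly = M.charpoly) :
    M.charpoly.reverse = (-1) ^ Fintype.card m * M.charpoly := by
  have hu : IsUnit M := (isUnit_iff_isUnit_det M).2 (by simp [hdet])
  rw [reverse_charpoly, ← h, charpoly_inv M hu, hdet]
  simp only [Ring.inverse_one, map_one, mul_one]
  rw [← mul_assoc, ← mul_pow]
  simp

/-- A symplectic matrix with squarefree characteristic polynomial does not have eigenvalue `1`. -/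
lemma isUnit_det_sub_one_of_mem_symplecticGroup {F l : Type*} [Field F] [Fintype l]
    [DecidableEq l] {s : Matrix (l ⊕ l) (l ⊕ l) F} (hs : s ∈ symplecticGroup l F)
    (hsq : Squarefree s.charpoly) : IsUnit (s - 1).det := by
  have hinv : s⁻¹ = (-J l F) * (sᵀ * J l F) := by
    refine inv_eq_left_inv ?_
    rw [Matrix.mul_assoc, SymplecticGroup.mem_iff'.1 hs, Matrix.neg_mul, J_squared, neg_neg]
  have hchar : s⁻¹.charpoly = s.charpoly := by
    rw [hinv, charpoly_mul_comm, Matrix.mul_assoc, Matrix.mul_neg, J_squared, neg_neg,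
      Matrix.mul_one, charpoly_transpose]
  have hcard : Even (Fintype.card (l ⊕ l)) := by simp
  have hrev := reverse_charpoly_of_charpoly_inv_eq (SymplecticGroup.det_eq_one hs) hchar
  rw [hcard.neg_one_pow, one_mul] at hrev
  have := eval_one_ne_zero_of_reverse_eq_self hrev
    (by rw [charpoly_natDegree_eq_dim]; exact hcard) hsq
  rw [eval_charpoly, ← neg_sub, det_neg, hcard.neg_one_pow, one_mul] at this
  simpa using this

/-- In odd dimension, the asymmetry of a nondegenerate bilinear form fixes some vector. -/
lemma det_sub_transpose_eq_zero {F m : Type*} [Field F] [Fintype m] [DecidableEq m]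
    (hodd : Odd (Fintype.card m)) {g : Matrix m m F} (hg : IsUnit g.det) :
    (g - gᵀ).det = 0 := by
  have hgT : IsUnit gᵀ.det := by rwa [det_transpose]
  have hdet : (g * gᵀ⁻¹).det = 1 := by
    rw [det_mul, det_nonsing_inv, det_transpose, Ring.mul_inverse_cancel _ hg]
  have hchar : (g * gᵀ⁻¹)⁻¹.charpoly = (g * gᵀ⁻¹).charpoly := by
    rw [Matrix.mul_inv_rev, nonsing_inv_nonsing_inv _ hgT, ← charpoly_transpose, transpose_mul,
      transpose_transpose, transpose_nonsing_inv, charpoly_mul_comm]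
  have hrev := reverse_charpoly_of_charpoly_inv_eq hdet hchar
  rw [hodd.neg_one_pow, neg_one_mul] at hrev
  have h1 := eval_one_eq_zero_of_reverse_eq_neg hrev (by rwa [charpoly_natDegree_eq_dim])
  rw [eval_charpoly] at h1
  have : g - gᵀ = -((scalar m (1 : F) - g * gᵀ⁻¹) * gᵀ) := by
    rw [Matrix.sub_mul, nonsing_inv_mul_cancel_right _ _ hgT]
    simp
  rw [this, det_neg, det_mul, h1, zero_mul, mul_zero]

/-- The generalized eigenspaces of an endomorphism with squarefree characteristic polynomial are
at most one-dimensional. -/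
lemma finrank_genEigenspace_le_one {F V : Type*} [Field F] [AddCommGroup V] [Module F V]
    [FiniteDimensional F V] {f : Module.End F V} (h : Squarefree f.charpoly) (μ : F) (k : ℕ∞) :
    Module.finrank F (f.genEigenspace μ k) ≤ 1 := by
  have h1 : f.charpoly.rootMultiplicity μ ≤ 1 := by
    by_contra! h2
    have := (le_rootMultiplicity_iff h.ne_zero).1 h2
    rw [Nat.succ_eq_add_one, one_add_one_eq_two, sq] at this
    exact not_isUnit_X_sub_C μ (h _ this)
  refine le_trans (Submodule.finrank_mono ((f.genEigenspace μ).monotone le_top)) ?_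
  exact (f.finrank_maxGenEigenspace_eq μ).trans_le h1

/-- Left and right eigenvectors for a simple eigenvalue are not orthogonal. -/
lemma dotProduct_ne_zero_of_squarefree_charpoly {F m : Type*} [Field F] [Fintype m]
    [DecidableEq m] {M : Matrix m m F} (h : Squarefree M.charpoly) {v w : m → F}
    (hv : v ≠ 0) (hw : w ≠ 0) (hvM : v ᵥ* M = v) (hMw : M *ᵥ w = w) : v ⬝ᵥ w ≠ 0 := by
  intro hvw
  set f : Module.End F (m → F) := toLin' M with hf
  have hsq : Squarefree f.charpoly := by rwa [hf, charpoly_toLin']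
  set N : Module.End F (m → F) := f - (1 : F) • 1 with hN
  have hNapp : ∀ x, N x = M *ᵥ x - x := fun x => by simp [hN, hf]
  have hker : Module.finrank F (LinearMap.ker N) ≤ 1 := by
    rw [hN, ← Module.End.genEigenspace_one]
    exact finrank_genEigenspace_le_one hsq 1 1
  set φ : Module.Dual F (m → F) := dotProductBilin F F v with hφ
  have hφapp : ∀ x, φ x = v ⬝ᵥ x := fun x => rfl
  have hφ0 : φ ≠ 0 := by
    intro h0
    refine hv (dotProduct_eq_zero v fun x => ?_)
    rw [← hφapp, h0, LinearMap.zero_apply]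
  have hle : LinearMap.range N ≤ LinearMap.ker φ := by
    rintro _ ⟨x, rfl⟩
    rw [LinearMap.mem_ker, hφapp, hNapp, dotProduct_sub, dotProduct_mulVec, hvM, sub_self]
  have hrank := LinearMap.finrank_range_add_finrank_ker N
  have hφrank := Module.Dual.finrank_ker_add_one_of_ne_zero hφ0
  have heq : LinearMap.range N = LinearMap.ker φ :=
    Submodule.eq_of_le_of_finrank_le hle (by omega)
  have hmem : w ∈ LinearMap.range N := by
    rw [heq, LinearMap.mem_ker, hφapp, hvw]
  obtain ⟨u, hu⟩ := hmem
  have hNw : N w = 0 := by rw [hNapp, hMw, sub_self]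
  have hu2 : u ∈ f.genEigenspace 1 (2 : ℕ) := by
    rw [Module.End.mem_genEigenspace_nat, LinearMap.mem_ker, ← hN, sq, Module.End.mul_apply, hu, hNw]
  have hw2 : w ∈ f.genEigenspace 1 (2 : ℕ) := by
    rw [Module.End.mem_genEigenspace_nat, LinearMap.mem_ker, ← hN, sq, Module.End.mul_apply, hNw,
      map_zero]
  obtain ⟨⟨e, he⟩, hspan⟩ := finrank_le_one_iff.1 (finrank_genEigenspace_le_one hsq 1 (2 : ℕ))
  obtain ⟨a, ha⟩ := hspan ⟨u, hu2⟩
  obtain ⟨b, hb⟩ := hspan ⟨w, hw2⟩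
  have ha' : a • e = u := congrArg Subtype.val ha
  have hb' : b • e = w := congrArg Subtype.val hb
  have hb0 : b ≠ 0 := by
    rintro rfl
    exact hw (by rw [← hb', zero_smul])
  have hNe : N e = 0 := by
    have : b • N e = 0 := by rw [← map_smul, hb', hNw]
    exact (smul_eq_zero.1 this).resolve_left hb0
  exact hw (by rw [← hu, ← ha', map_smul, hNe, smul_zero])

/-- A nondegenerate alternating form admits a partial symplectic basis of any size allowed by the
dimension. -/
lemma exists_symplectic_family {F : Type*} [Field F] (n : ℕ) {V : Type*} [AddCommGroup V]
    [Module F V] [FiniteDimensional F V] (B : V →ₗ[F] V →ₗ[F] F) (halt : B.IsAlt)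
    (hnd : ∀ x, (∀ y, B x y = 0) → x = 0) (hdim : 2 * n ≤ Module.finrank F V) :
    ∃ b : Fin n ⊕ Fin n → V, ∀ i j, B (b i) (b j) = J (Fin n) F i j := by
  suffices H : ∃ e f : Fin n → V, (∀ i j, B (e i) (e j) = 0) ∧ (∀ i j, B (f i) (f j) = 0) ∧
      ∀ i j, B (f i) (e j) = if i = j then 1 else 0 by
    obtain ⟨e, f, hee, hff, hfe⟩ := H
    refine ⟨Sum.elim e f, ?_⟩
    rintro (i | i) (j | j)
    · simp [J, hee]
    · rw [Sum.elim_inl, Sum.elim_inr, ← halt.neg, hfe]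
      simp [J, one_apply, eq_comm]
    · simp [J, hfe, one_apply]
    · simp [J, hff]
  induction n generalizing V with
  | zero => exact ⟨Fin.elim0, Fin.elim0, fun i => i.elim0, fun i => i.elim0, fun i => i.elim0⟩
  | succ n ih =>
    have : Nontrivial V := Module.nontrivial_of_finrank_pos (R := F) (by omega)
    obtain ⟨v, hv⟩ := exists_ne (0 : V)
    obtain ⟨y, hy⟩ : ∃ y, B v y ≠ 0 := by
      by_contra! h
      exact hv (hnd v h)
    obtain ⟨w, hw⟩ : ∃ w, B v w = 1 := ⟨(B v y)⁻¹ • y, by simp [hy]⟩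
    have hwv : B w v = -1 := by rw [← halt.neg, hw]
    set W : Submodule F V := LinearMap.ker ((B v).prod (B w)) with hW
    have hmem : ∀ x, x ∈ W ↔ B v x = 0 ∧ B w x = 0 := by
      intro x
      simp [hW]
    have hWdim : 2 * n ≤ Module.finrank F W := by
      have h1 := LinearMap.finrank_range_add_finrank_ker ((B v).prod (B w))
      have h2 := Submodule.finrank_le (LinearMap.range ((B v).prod (B w)))
      rw [Module.finrank_prod, Module.finrank_self] at h2
      rw [← hW] at h1
      omega
    obtain ⟨e, f, hee, hff, hfe⟩ := ih (B.compl₁₂ W.subtype W.subtype) (fun x => halt x) (by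
      intro x hx
      apply Subtype.ext
      refine hnd x fun z => ?_
      obtain ⟨h1, h2⟩ := (hmem x).1 x.2
      have h1' : B x v = 0 := by rw [← halt.neg, h1, neg_zero]
      have h2' : B x w = 0 := by rw [← halt.neg, h2, neg_zero]
      have hz : z - B v z • w + B w z • v ∈ W := by
        rw [hmem]
        simp [halt v, halt w, hw, hwv]
      have := hx ⟨_, hz⟩
      simpa [h1', h2'] using this) hWdim
    have hve : ∀ x : W, B v x = 0 := fun x => ((hmem x).1 x.2).1
    have hwe : ∀ x : W, B w x = 0 := fun x => ((hmem x).1 x.2).2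
    have hev : ∀ x : W, B x v = 0 := fun x => by rw [← halt.neg, hve, neg_zero]
    have hew : ∀ x : W, B x w = 0 := fun x => by rw [← halt.neg, hwe, neg_zero]
    simp only [LinearMap.compl₁₂_apply, Submodule.subtype_apply] at hee hff hfe
    refine ⟨Fin.cons w fun i => e i, Fin.cons v fun i => f i, ?_, ?_, ?_⟩
    · intro i j
      cases i using Fin.cases <;> cases j using Fin.cases <;> simp [halt w, hwe, hew, hee]
    · intro i j
      cases i using Fin.cases <;> cases j using Fin.cases <;> simp [halt v, hve, hev, hff]
    · intro i j
      cases i using Fin.cases <;> cases j using Fin.cases <;>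
        simp [hw, hve, hew, hfe, (Fin.succ_ne_zero _).symm]

/-- A matrix is in normal form if it is the orthogonal sum of a one-dimensional bilinear form and a
bilinear form whose alternating part is the standard symplectic form. -/
def IsNormalForm {F l : Type*} [Field F] [DecidableEq l]
    (M : Matrix (Unit ⊕ (l ⊕ l)) (Unit ⊕ (l ⊕ l)) F) : Prop :=
  ∃ (A : Matrix Unit Unit F) (B : Matrix (l ⊕ l) (l ⊕ l) F),
    B - Bᵀ = J l F ∧ M = fromBlocks A 0 0 B

/-- Two vectors in the radical of the alternating part of a bilinear form with regular semisimple
asymmetry are not orthogonal. -/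
lemma dotProduct_mulVec_ne_zero_of_radical {F m : Type*} [Field F] [Fintype m] [DecidableEq m]
    {g : Matrix m m F} (hg : IsUnit g.det) (hsq : Squarefree (g * gᵀ⁻¹).charpoly) {v u : m → F}
    (hv0 : v ≠ 0) (hu0 : u ≠ 0) (hv : g *ᵥ v = gᵀ *ᵥ v) (hu : g *ᵥ u = gᵀ *ᵥ u) :
    v ⬝ᵥ g *ᵥ u ≠ 0 := by
  have hgT : IsUnit gᵀ.det := by rwa [det_transpose]
  refine dotProduct_ne_zero_of_squarefree_charpoly hsq hv0 ?_ ?_ ?_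
  · intro h
    refine hu0 ?_
    rw [← one_mulVec u, ← nonsing_inv_mul _ hg, ← mulVec_mulVec, h, mulVec_zero]
  · rw [← vecMul_vecMul, ← mulVec_transpose g, ← hv, ← vecMul_transpose, vecMul_vecMul,
      mul_nonsing_inv _ hgT, vecMul_one]
  · rw [hu, mulVec_mulVec, nonsing_inv_mul_cancel_right _ _ hgT, hu]

/-- Every bilinear form with regular semisimple asymmetry in odd dimension has a normal form. -/
lemma exists_isNormalForm {F : Type*} [Field F] {n : ℕ}
    {g : Matrix (Unit ⊕ (Fin n ⊕ Fin n)) (Unit ⊕ (Fin n ⊕ Fin n)) F} (hg : IsUnit g.det)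
    (hsq : Squarefree (g * gᵀ⁻¹).charpoly) :
    ∃ h : GL (Unit ⊕ (Fin n ⊕ Fin n)) F, IsNormalForm (h.valᵀ * g * h.val) := by
  have hodd : Odd (Fintype.card (Unit ⊕ (Fin n ⊕ Fin n))) := by
    simp only [Fintype.card_sum, Fintype.card_unit, Fintype.card_fin]
    exact ⟨n, by ring⟩
  obtain ⟨v, hv0, hv⟩ := exists_mulVec_eq_zero_iff.2 (det_sub_transpose_eq_zero hodd hg)
  rw [sub_mulVec, sub_eq_zero] at hv
  have ha := dotProduct_mulVec_ne_zero_of_radical hg hsq hv0 hv0 hv hv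
  set φ : Module.Dual F (Unit ⊕ (Fin n ⊕ Fin n) → F) :=
    (dotProductBilin F F v).comp (toLin' g) with hφ
  have hφapp : ∀ x, φ x = v ⬝ᵥ g *ᵥ x := fun x => rfl
  have hφ' : ∀ x, x ⬝ᵥ g *ᵥ v = φ x := by
    intro x
    rw [hv, hφapp, mulVec_transpose, dotProduct_comm, dotProduct_mulVec]
  have hφ0 : φ ≠ 0 := fun h0 => ha (by rw [← hφapp, h0, LinearMap.zero_apply])
  set W := LinearMap.ker φ with hW
  have hWdim : 2 * n ≤ Module.finrank F W := by
    have : Module.finrank F W + 1 = _ := Module.Dual.finrank_ker_add_one_of_ne_zero hφ0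
    simp only [Module.finrank_fintype_fun_eq_card, Fintype.card_sum, Fintype.card_unit,
      Fintype.card_fin] at this
    omega
  set A := Matrix.toBilin' (g - gᵀ) with hA
  have hAapp : ∀ x y, A x y = x ⬝ᵥ g *ᵥ y - y ⬝ᵥ g *ᵥ x := by
    intro x y
    rw [hA, toBilin'_apply', sub_mulVec, dotProduct_sub, mulVec_transpose,
      dotProduct_comm x (y ᵥ* g), ← dotProduct_mulVec y]
  obtain ⟨b, hb⟩ := exists_symplectic_family n (A.compl₁₂ W.subtype W.subtype)
    (fun x => by simp [hAapp]) (by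
      intro x hx
      by_contra hx0
      have hxv : A x v = 0 := by rw [hAapp, hφ', hφapp, sub_self]
      have hxz : ∀ z, A x z = 0 := by
        intro z
        have hz : z - (φ z / φ v) • v ∈ W := by
          rw [hW, LinearMap.mem_ker, map_sub, map_smul, smul_eq_mul, div_mul_cancel₀ (φ z) (b := φ v) ha,
            sub_self]
        have := hx ⟨_, hz⟩
        simpa [hxv] using this
      have hxr : g *ᵥ (x : _ → F) = gᵀ *ᵥ x := by
        rw [← sub_eq_zero]
        refine dotProduct_eq_zero _ fun z => ?_
        have := hxz z
        rw [hAapp, ← neg_sub, neg_eq_zero] at this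
        rw [sub_dotProduct, dotProduct_comm, mulVec_transpose, ← dotProduct_mulVec]
        exact this
      exact dotProduct_mulVec_ne_zero_of_radical hg hsq hv0 (fun h => hx0 (Subtype.ext h)) hv hxr
        x.2) hWdim
  simp only [LinearMap.compl₁₂_apply, Submodule.subtype_apply] at hb
  have hbφ : ∀ i, φ (b i) = 0 := fun i => (b i).2
  set Q : Matrix (Unit ⊕ (Fin n ⊕ Fin n)) (Unit ⊕ (Fin n ⊕ Fin n)) F :=
    of (Sum.elim (fun _ => v) (fun i => (b i : _ → F))) with hQ
  have hentry : ∀ i j, (Q * g * Qᵀ) i j = Q i ⬝ᵥ g *ᵥ Q j := fun i j => mul_mul_apply _ _ _ _ _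
  have hQu : IsUnit Q.det := by
    set R : Matrix (Unit ⊕ (Fin n ⊕ Fin n)) (Unit ⊕ (Fin n ⊕ Fin n)) F :=
      of (Sum.elim (fun _ => g *ᵥ v) (fun i => (b i : _ → F) ᵥ* (g - gᵀ))) with hR
    have hRQ : R * Qᵀ = fromBlocks (of fun _ _ => φ v) 0 0 (J (Fin n) F) := by
      ext i j
      have : (R * Qᵀ) i j = R i ⬝ᵥ Q j := rfl
      rw [this]
      rcases i with i | i <;> rcases j with j | j
      · exact dotProduct_comm _ _
      · exact (dotProduct_comm _ _).trans ((hφ' _).trans (hbφ j))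
      · change (b i : _ → F) ᵥ* (g - gᵀ) ⬝ᵥ v = 0
        rw [← dotProduct_mulVec, sub_mulVec, hv, sub_self, dotProduct_zero]
      · have := hb i j
        rw [hA, toBilin'_apply', dotProduct_mulVec] at this
        exact this
    have hdet := congrArg det hRQ
    rw [det_mul, det_transpose, det_fromBlocks_zero₂₁] at hdet
    refine isUnit_of_mul_isUnit_right (x := R.det) ?_
    rw [hdet]
    refine IsUnit.mul ?_ (isUnit_det_J _ _)
    simpa [hφapp] using ha
  refine ⟨GeneralLinearGroup.mk'' Qᵀ (by rwa [det_transpose]), (Q * g * Qᵀ).toBlocks₁₁,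
    (Q * g * Qᵀ).toBlocks₂₂, ?_, ?_⟩
  · ext i j
    rw [← hb, hAapp, Matrix.sub_apply, transpose_apply]
    simp only [toBlocks₂₂, of_apply, hentry]
    rfl
  · change Qᵀᵀ * g * Qᵀ = _
    rw [transpose_transpose]
    conv_lhs => rw [← fromBlocks_toBlocks (Q * g * Qᵀ)]
    congr 1
    · ext i j
      simp only [toBlocks₁₂, of_apply, hentry]
      exact hbφ j
    · ext i j
      simp only [toBlocks₂₁, of_apply, hentry]
      exact (hφ' _).trans (hbφ i)

/-- A congruence between two normal forms is block diagonal with symplectic second block. -/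
lemma IsNormalForm.congr_iff {F l : Type*} [Field F] [Fintype l] [DecidableEq l]
    {M k : Matrix (Unit ⊕ (l ⊕ l)) (Unit ⊕ (l ⊕ l)) F} (hM : IsNormalForm M)
    (hMu : IsUnit M.det) (hk : IsUnit k.det) :
    IsNormalForm (kᵀ * M * k) ↔
      ∃ C : GL Unit F, ∃ s ∈ symplecticGroup l F, k = fromBlocks C.val 0 0 s := by
  obtain ⟨A, B, hB, rfl⟩ := hM
  have hsymm : ∀ A : Matrix Unit Unit F, Aᵀ = A := fun A => by ext; rfl
  constructor
  · rintro ⟨A', B', hB', h⟩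
    rw [← fromBlocks_toBlocks k] at h hk ⊢
    set p := k.toBlocks₁₁
    set q := k.toBlocks₁₂
    set r := k.toBlocks₂₁
    set s := k.toBlocks₂₂
    have hJ : (fromBlocks p q r s)ᵀ * fromBlocks 0 0 0 (J l F) * fromBlocks p q r s =
        fromBlocks 0 0 0 (J l F) := by
      have h1 : fromBlocks 0 0 0 (J l F) = fromBlocks A 0 0 B - (fromBlocks A 0 0 B)ᵀ := by
        rw [fromBlocks_transpose, sub_eq_add_neg, fromBlocks_neg, fromBlocks_add,
          ← sub_eq_add_neg B, hB, hsymm]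
        simp
      have h2 : fromBlocks 0 0 0 (J l F) = fromBlocks A' 0 0 B' - (fromBlocks A' 0 0 B')ᵀ := by
        rw [fromBlocks_transpose, sub_eq_add_neg, fromBlocks_neg, fromBlocks_add,
          ← sub_eq_add_neg B', hB', hsymm]
        simp
      conv_rhs => rw [h2, ← h]
      rw [h1]
      simp only [transpose_mul, transpose_transpose, Matrix.mul_sub, Matrix.sub_mul,
        Matrix.mul_assoc]
    rw [fromBlocks_transpose, fromBlocks_multiply, fromBlocks_multiply, fromBlocks_inj] at hJ
    simp only [Matrix.mul_zero, add_zero, zero_add, Matrix.zero_mul] at hJ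
    obtain ⟨-, -, hsr, hss⟩ := hJ
    have hs : s ∈ symplecticGroup l F := SymplecticGroup.mem_iff'.2 hss
    have hsu : IsUnit (sᵀ * J l F).det := by
      rw [det_mul, det_transpose]
      exact (SymplecticGroup.symplectic_det hs).mul (isUnit_det_J l F)
    have hr : r = 0 := by
      rw [← nonsing_inv_mul_cancel_left _ r hsu, hsr, Matrix.mul_zero]
    rw [hr, det_fromBlocks_zero₂₁] at hk
    have hp : IsUnit p := (isUnit_iff_isUnit_det p).2 (isUnit_of_mul_isUnit_left hk)
    rw [det_fromBlocks_zero₂₁] at hMu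
    have hA : IsUnit A := (isUnit_iff_isUnit_det A).2 (isUnit_of_mul_isUnit_left hMu)
    rw [hr, fromBlocks_transpose, fromBlocks_multiply, fromBlocks_multiply, fromBlocks_inj] at h
    simp only [Matrix.mul_zero, add_zero, zero_add, Matrix.zero_mul, transpose_zero, hsymm p] at h
    have hq : q = 0 := by
      have hu : IsUnit (p * A).det := (isUnit_iff_isUnit_det _).1 (hp.mul hA)
      rw [← nonsing_inv_mul_cancel_left _ q hu, h.2.1, Matrix.mul_zero]
    exact ⟨hp.unit, s, hs, by rw [hr, hq]; rfl⟩
  · rintro ⟨C, s, hs, rfl⟩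
    refine ⟨C.valᵀ * A * C.val, sᵀ * B * s, ?_, ?_⟩
    · rw [← SymplecticGroup.mem_iff'.1 hs, ← hB]
      simp only [transpose_mul, transpose_transpose, Matrix.mul_sub, Matrix.sub_mul,
        Matrix.mul_assoc]
    · rw [fromBlocks_transpose, fromBlocks_multiply, fromBlocks_multiply]
      simp

/-- The Cayley-type transform of a symplectic matrix without eigenvalue `1` is the Gram matrix of a
bilinear form with alternating part `J` whose transpose is `(s - 1)⁻¹ * J`. -/
lemma transpose_mul_inv_sub_one_mul_J {F l : Type*} [Field F] [Fintype l] [DecidableEq l]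
    {s : Matrix (l ⊕ l) (l ⊕ l) F} (hs : s ∈ symplecticGroup l F) (hu : IsUnit (s - 1).det) :
    (s * (s - 1)⁻¹ * J l F)ᵀ = (s - 1)⁻¹ * J l F := by
  have huT : IsUnit (s - 1)ᵀ.det := by rwa [det_transpose]
  have hcomm : s * (s - 1)⁻¹ = (s - 1)⁻¹ * s := by
    have : s = (s - 1) + 1 := by rw [sub_add_cancel]
    nth_rw 1 [this]
    nth_rw 4 [this]
    rw [Matrix.add_mul, Matrix.mul_add, mul_nonsing_inv _ hu, nonsing_inv_mul _ hu, Matrix.one_mul,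
      Matrix.mul_one]
  have key : (s * (s - 1)⁻¹ * J l F) * (s - 1)ᵀ = -J l F := by
    have h1 : (s * (s - 1)⁻¹ * J l F) * sᵀ = (s - 1)⁻¹ * J l F := by
      rw [hcomm, Matrix.mul_assoc, Matrix.mul_assoc, ← Matrix.mul_assoc s,
        SymplecticGroup.mem_iff.1 hs]
    rw [transpose_sub, transpose_one, Matrix.mul_sub, Matrix.mul_one, h1, Matrix.mul_assoc,
      ← neg_sub, ← sub_one_mul, mul_nonsing_inv_cancel_left _ _ hu]
  rw [← mul_nonsing_inv_cancel_right _ (s * (s - 1)⁻¹ * J l F) huT, key, transpose_mul,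
    transpose_neg, J_transpose, neg_neg, transpose_nonsing_inv, transpose_transpose]

/-- The asymmetry of a nondegenerate bilinear form with alternating part `J` is symplectic. -/
lemma mul_transpose_inv_mem_symplecticGroup {F l : Type*} [Field F] [Fintype l] [DecidableEq l]
    {B : Matrix (l ⊕ l) (l ⊕ l) F} (hB : B - Bᵀ = J l F) (hu : IsUnit B.det) :
    B * Bᵀ⁻¹ ∈ symplecticGroup l F := by
  have huT : IsUnit Bᵀ.det := by rwa [det_transpose]
  rw [SymplecticGroup.mem_iff, ← hB, transpose_mul, transpose_nonsing_inv, transpose_transpose,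
    Matrix.mul_sub, nonsing_inv_mul_cancel_right _ _ huT, Matrix.sub_mul,
    mul_nonsing_inv_cancel_left _ _ hu, Matrix.mul_assoc, Matrix.mul_assoc,
    mul_nonsing_inv_cancel_left _ _ hu, nonsing_inv_mul _ huT, Matrix.mul_one]

/-- Nondegenerate bilinear forms with alternating part `J` and regular semisimple asymmetry
correspond to regular semisimple symplectic matrices, via the asymmetry. -/
noncomputable def asymmetryEquiv (F l : Type*) [Field F] [Fintype l] [DecidableEq l] :
    {B : GL (l ⊕ l) F // B.val - B.valᵀ = J l F ∧ Squarefree (B.val * B.valᵀ⁻¹).charpoly} ≃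
      {s : Matrix (l ⊕ l) (l ⊕ l) F // s ∈ symplecticGroup l F ∧ Squarefree s.charpoly} := by
  refine Equiv.ofBijective (fun B => ⟨B.1.val * B.1.valᵀ⁻¹,
    mul_transpose_inv_mem_symplecticGroup B.2.1 ((isUnit_iff_isUnit_det _).1 B.1.isUnit), B.2.2⟩)
    ⟨?_, ?_⟩
  · rintro ⟨B, hB, hBs⟩ ⟨B', hB', hBs'⟩ h
    simp only [Subtype.mk.injEq] at h ⊢
    have hrec : ∀ C : GL (l ⊕ l) F, C.val - C.valᵀ = J l F →
        (C.val * C.valᵀ⁻¹ - 1) * C.valᵀ = J l F := by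
      intro C hC
      have hCT : IsUnit C.valᵀ.det := by
        rw [det_transpose]
        exact (isUnit_iff_isUnit_det _).1 C.isUnit
      rw [Matrix.sub_mul, nonsing_inv_mul_cancel_right _ _ hCT, Matrix.one_mul, hC]
    have hu := isUnit_det_sub_one_of_mem_symplecticGroup
      (mul_transpose_inv_mem_symplecticGroup hB ((isUnit_iff_isUnit_det _).1 B.isUnit)) hBs
    have h1 := hrec B hB
    have h2 := hrec B' hB'
    rw [← h, ← h1] at h2
    refine Units.ext (transpose_injective ?_)
    rw [← nonsing_inv_mul_cancel_left _ B.valᵀ hu, ← h2, nonsing_inv_mul_cancel_left _ _ hu]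
  · rintro ⟨s, hs, hsq⟩
    have hu := isUnit_det_sub_one_of_mem_symplecticGroup hs hsq
    have hT := transpose_mul_inv_sub_one_mul_J hs hu
    have hBu : IsUnit (s * (s - 1)⁻¹ * J l F).det := by
      rw [det_mul, det_mul]
      exact ((SymplecticGroup.symplectic_det hs).mul (isUnit_nonsing_inv_det _ hu)).mul
        (isUnit_det_J l F)
    have hasym : (s * (s - 1)⁻¹ * J l F) * (s * (s - 1)⁻¹ * J l F)ᵀ⁻¹ = s := by
      have hBT : IsUnit (s * (s - 1)⁻¹ * J l F)ᵀ.det := by rwa [det_transpose]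
      have hsB : s * (s - 1)⁻¹ * J l F = s * (s * (s - 1)⁻¹ * J l F)ᵀ := by
        rw [hT, Matrix.mul_assoc]
      exact (congrArg (· * _) hsB).trans (mul_nonsing_inv_cancel_right _ s hBT)
    refine ⟨⟨GeneralLinearGroup.mk'' _ hBu, ?_, ?_⟩, Subtype.ext hasym⟩
    · change s * (s - 1)⁻¹ * J l F - (s * (s - 1)⁻¹ * J l F)ᵀ = J l F
      rw [hT, Matrix.mul_assoc, ← sub_one_mul, mul_nonsing_inv_cancel_left _ _ hu]
    · change Squarefree ((s * (s - 1)⁻¹ * J l F) * (s * (s - 1)⁻¹ * J l F)ᵀ⁻¹).charpoly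
      rwa [hasym]

/-- The transpose of an element of the general linear group. -/
def glTranspose {m F : Type*} [Field F] [Fintype m] [DecidableEq m] (g : GL m F) : GL m F where
  val := g.valᵀ
  inv := (g⁻¹).valᵀ
  val_inv := by rw [← transpose_mul, ← Units.val_mul, inv_mul_cancel, Units.val_one, transpose_one]
  inv_val := by rw [← transpose_mul, ← Units.val_mul, mul_inv_cancel, Units.val_one, transpose_one]

/-- The asymmetries of congruent bilinear forms have the same characteristic polynomial. -/
lemma charpoly_asymmetry_congr {m F : Type*} [Field F] [Fintype m] [DecidableEq m] (g h : GL m F) :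
    ((glTranspose h * g * h).val * (glTranspose h * g * h).valᵀ⁻¹).charpoly =
      (g.val * g.valᵀ⁻¹).charpoly := by
  have hh : IsUnit h.val.det := (isUnit_iff_isUnit_det _).1 h.isUnit
  have hhT : IsUnit h.valᵀ.det := by rwa [det_transpose]
  change ((h.valᵀ * g.val * h.val) * (h.valᵀ * g.val * h.val)ᵀ⁻¹).charpoly = _
  rw [transpose_mul, transpose_mul, transpose_transpose, Matrix.mul_inv_rev, Matrix.mul_inv_rev,
    ← Matrix.mul_assoc, ← Matrix.mul_assoc, mul_nonsing_inv_cancel_right _ _ hh, charpoly_mul_comm,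
    ← Matrix.mul_assoc, ← Matrix.mul_assoc, nonsing_inv_mul _ hhT, Matrix.one_mul]

/-- The asymmetry of an orthogonal sum with a one-dimensional form. -/
lemma charpoly_asymmetry_fromBlocks {F l : Type*} [Field F] [Fintype l] [DecidableEq l]
    {A : Matrix Unit Unit F} {B : Matrix (l ⊕ l) (l ⊕ l) F} (hA : IsUnit A.det)
    (hB : IsUnit B.det) :
    (fromBlocks A 0 0 B * (fromBlocks A 0 0 B)ᵀ⁻¹).charpoly =
      (X - C 1) * (B * Bᵀ⁻¹).charpoly := by
  have hAT : Aᵀ = A := by ext; rfl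
  have hBT : IsUnit Bᵀ.det := by rwa [det_transpose]
  have hinv : (fromBlocks A 0 0 B)ᵀ⁻¹ = fromBlocks A⁻¹ 0 0 Bᵀ⁻¹ := by
    refine inv_eq_right_inv ?_
    rw [fromBlocks_transpose, fromBlocks_multiply, hAT, mul_nonsing_inv _ hA,
      mul_nonsing_inv _ hBT]
    simp
  rw [hinv, fromBlocks_multiply, mul_nonsing_inv _ hA]
  simp only [Matrix.mul_zero, Matrix.zero_mul, add_zero, zero_add, charpoly_fromBlocks_zero₁₂]
  simp [charpoly_one]

/-- Regular semisimplicity of the asymmetry is unaffected by adding a one-dimensional summand. -/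
lemma squarefree_charpoly_asymmetry_fromBlocks_iff {F l : Type*} [Field F] [Fintype l]
    [DecidableEq l] {A : Matrix Unit Unit F} {B : Matrix (l ⊕ l) (l ⊕ l) F} (hA : IsUnit A.det)
    (hB : IsUnit B.det) (hJ : B - Bᵀ = J l F) :
    Squarefree (fromBlocks A 0 0 B * (fromBlocks A 0 0 B)ᵀ⁻¹).charpoly ↔
      Squarefree (B * Bᵀ⁻¹).charpoly := by
  rw [charpoly_asymmetry_fromBlocks hA hB]
  refine ⟨Squarefree.of_mul_right, fun h => ?_⟩
  have hu := isUnit_det_sub_one_of_mem_symplecticGroup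
    (mul_transpose_inv_mem_symplecticGroup hJ hB) h
  have hcop : IsCoprime (X - C 1) (B * Bᵀ⁻¹).charpoly := by
    rw [(irreducible_X_sub_C (1 : F)).coprime_iff_not_dvd, dvd_iff_isRoot, IsRoot, eval_charpoly,
      ← neg_sub, det_neg]
    simpa using hu
  exact (squarefree_mul_iff.2 ⟨hcop.isRelPrime, (irreducible_X_sub_C (1 : F)).squarefree, h⟩)

/-- Block diagonal matrices as elements of the general linear group. -/
def glFromBlocks {m n F : Type*} [Field F] [Fintype m] [DecidableEq m] [Fintype n] [DecidableEq n]
    (A : GL m F) (B : GL n F) : GL (m ⊕ n) F where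
  val := fromBlocks A.val 0 0 B.val
  inv := fromBlocks (A⁻¹).val 0 0 (B⁻¹).val
  val_inv := by
    rw [fromBlocks_multiply, ← Units.val_mul, ← Units.val_mul]
    simp
  inv_val := by
    rw [fromBlocks_multiply, ← Units.val_mul, ← Units.val_mul]
    simp

/-- Regular semisimple normal forms are counted by their two blocks. -/
lemma card_normalForms (F l : Type*) [Field F] [Fintype l] [DecidableEq l] :
    Nat.card {M : GL (Unit ⊕ (l ⊕ l)) F //
        Squarefree (M.val * M.valᵀ⁻¹).charpoly ∧ IsNormalForm M.val} =
      Nat.card (GL Unit F) * Nat.card {s : Matrix (l ⊕ l) (l ⊕ l) F //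
        s ∈ symplecticGroup l F ∧ Squarefree s.charpoly} := by
  rw [← Nat.card_congr (asymmetryEquiv F l), ← Nat.card_prod]
  refine (Nat.card_congr (Equiv.ofBijective (fun p => ⟨glFromBlocks p.1 p.2.1,
    (squarefree_charpoly_asymmetry_fromBlocks_iff ((isUnit_iff_isUnit_det _).1 p.1.isUnit)
      ((isUnit_iff_isUnit_det _).1 p.2.1.isUnit) p.2.2.1).2 p.2.2.2,
    p.1.val, p.2.1.val, p.2.2.1, rfl⟩) ⟨?_, ?_⟩)).symm
  · rintro ⟨A, B, hB⟩ ⟨A', B', hB'⟩ h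
    have h1 : fromBlocks A.val 0 0 B.val = fromBlocks A'.val 0 0 B'.val :=
      congrArg (fun x => x.1.val) h
    obtain ⟨h2, -, -, h3⟩ := fromBlocks_inj.1 h1
    obtain rfl := Units.ext h2
    obtain rfl := Units.ext h3
    rfl
  · rintro ⟨M, hM, A, B, hB, h⟩
    have hMu := (isUnit_iff_isUnit_det _).1 M.isUnit
    rw [h, det_fromBlocks_zero₂₁] at hMu
    have hAu := isUnit_of_mul_isUnit_left hMu
    have hBu := isUnit_of_mul_isUnit_right hMu
    rw [h, squarefree_charpoly_asymmetry_fromBlocks_iff hAu hBu hB] at hM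
    exact ⟨⟨GeneralLinearGroup.mk'' A hAu, GeneralLinearGroup.mk'' B hBu, hB, hM⟩,
      Subtype.ext (Units.ext h.symm)⟩

/-- The block diagonal matrices preserving normal forms are counted by their two blocks. -/
lemma card_stabilizer (F l : Type*) [Field F] [Fintype l] [DecidableEq l] :
    Nat.card {k : GL (Unit ⊕ (l ⊕ l)) F //
        ∃ C : GL Unit F, ∃ s ∈ symplecticGroup l F, k.val = fromBlocks C.val 0 0 s} =
      Nat.card (GL Unit F) * Nat.card (symplecticGroup l F) := by
  rw [← Nat.card_prod]
  refine (Nat.card_congr (Equiv.ofBijective (fun p => ⟨glFromBlocks p.1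
    (GeneralLinearGroup.mk'' p.2.1 (SymplecticGroup.symplectic_det p.2.2)), p.1, p.2.1, p.2.2, rfl⟩)
    ⟨?_, ?_⟩)).symm
  · rintro ⟨A, B, hB⟩ ⟨A', B', hB'⟩ h
    have h1 : fromBlocks A.val 0 0 B = fromBlocks A'.val 0 0 B' :=
      congrArg (fun x => x.1.val) h
    obtain ⟨h2, -, -, rfl⟩ := fromBlocks_inj.1 h1
    obtain rfl := Units.ext h2
    rfl
  · rintro ⟨k, C, s, hs, h⟩
    exact ⟨⟨C, s, hs⟩, Subtype.ext (Units.ext h.symm)⟩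

/-- Double count of the ways to bring a form with regular semisimple asymmetry to normal form. -/
lemma card_mul_card_stabilizer (F : Type*) [Field F] (n : ℕ) :
    Nat.card {g : GL (Unit ⊕ (Fin n ⊕ Fin n)) F // Squarefree (g.val * g.valᵀ⁻¹).charpoly} *
      Nat.card {k : GL (Unit ⊕ (Fin n ⊕ Fin n)) F //
        ∃ C : GL Unit F, ∃ s ∈ symplecticGroup (Fin n) F, k.val = fromBlocks C.val 0 0 s} =
    Nat.card (GL (Unit ⊕ (Fin n ⊕ Fin n)) F) *
      Nat.card {M : GL (Unit ⊕ (Fin n ⊕ Fin n)) F //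
        Squarefree (M.val * M.valᵀ⁻¹).charpoly ∧ IsNormalForm M.val} := by
  have hu : ∀ g : GL (Unit ⊕ (Fin n ⊕ Fin n)) F, IsUnit g.val.det :=
    fun g => (isUnit_iff_isUnit_det _).1 g.isUnit
  have hmul : ∀ h k : GL (Unit ⊕ (Fin n ⊕ Fin n)) F,
      glTranspose (h * k) = glTranspose k * glTranspose h := fun h k =>
    Units.ext (transpose_mul h.val k.val)
  have hex : ∀ g : {g : GL (Unit ⊕ (Fin n ⊕ Fin n)) F //
      Squarefree (g.val * g.valᵀ⁻¹).charpoly}, ∃ h : GL (Unit ⊕ (Fin n ⊕ Fin n)) F,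
      IsNormalForm (glTranspose h * g.1 * h).val := fun g => exists_isNormalForm (hu g.1) g.2
  choose h₀ hh₀ using hex
  have hnormal : ∀ g k, IsNormalForm (glTranspose (h₀ g * k) * g.1 * (h₀ g * k)).val ↔
      ∃ C : GL Unit F, ∃ s ∈ symplecticGroup (Fin n) F, k.val = fromBlocks C.val 0 0 s := by
    intro g k
    rw [← (hh₀ g).congr_iff (hu _) (hu k), hmul]
    simp only [mul_assoc, Units.val_mul]
    rfl
  rw [← Nat.card_prod, ← Nat.card_prod]
  refine Nat.card_congr (Equiv.ofBijective (fun p => ⟨h₀ p.1 * p.2.1,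
    glTranspose (h₀ p.1 * p.2.1) * p.1.1 * (h₀ p.1 * p.2.1),
    by rw [charpoly_asymmetry_congr]; exact p.1.2, (hnormal _ _).2 p.2.2⟩) ⟨?_, ?_⟩)
  · rintro ⟨g, k, hk⟩ ⟨g', k', hk'⟩ h
    simp only [Prod.mk.injEq, Subtype.mk.injEq] at h
    obtain ⟨h1, h2⟩ := h
    rw [h1] at h2
    have hg : g = g' := Subtype.ext (mul_left_cancel (mul_right_cancel h2))
    subst hg
    have hkk : k = k' := mul_left_cancel h1
    subst hkk
    rfl
  · rintro ⟨h, M, hM, hMn⟩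
    have hcancel : glTranspose h * ((glTranspose h)⁻¹ * M * h⁻¹) * h = M := by group
    set g : {g : GL (Unit ⊕ (Fin n ⊕ Fin n)) F // Squarefree (g.val * g.valᵀ⁻¹).charpoly} :=
      ⟨(glTranspose h)⁻¹ * M * h⁻¹, by rwa [← charpoly_asymmetry_congr _ h, hcancel]⟩ with hg
    have hhk : h₀ g * ((h₀ g)⁻¹ * h) = h := mul_inv_cancel_left _ _
    refine ⟨⟨g, (h₀ g)⁻¹ * h, (hnormal g _).1 ?_⟩, ?_⟩
    · rw [hhk]
      simpa only [hg, hcancel] using hMn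
    · refine Prod.ext hhk (Subtype.ext ?_)
      change glTranspose (h₀ g * ((h₀ g)⁻¹ * h)) * g.1 * (h₀ g * ((h₀ g)⁻¹ * h)) = M
      rw [hhk]
      exact hcancel

theorem stmt6 (q n : ℕ) (hq : IsPrimePow q) (hn : 1 ≤ n)
    (F : Type) [Field F] [Fintype F] (hF : Fintype.card F = q) :
    Nat.card {g : GL (Fin (2 * n + 1)) F // Squarefree ((g * tau g).val.charpoly)} *
      Nat.card (Matrix.symplecticGroup (Fin n) F) =
    Nat.card {s : Matrix (Fin n ⊕ Fin n) (Fin n ⊕ Fin n) F //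
        s ∈ Matrix.symplecticGroup (Fin n) F ∧ Squarefree s.charpoly} *
      Nat.card (GL (Fin (2 * n + 1)) F) := by
  have e : Fin (2 * n + 1) ≃ Unit ⊕ (Fin n ⊕ Fin n) := Fintype.equivOfCardEq (by
    simp only [Fintype.card_sum, Fintype.card_unit, Fintype.card_fin]
    ring)
  let E : GL (Fin (2 * n + 1)) F ≃* GL (Unit ⊕ (Fin n ⊕ Fin n)) F :=
    Units.mapEquiv (reindexAlgEquiv F F e).toMulEquiv
  have hE : ∀ g, (E g).val = reindex e e g.val := fun g => rfl
  have hX : Nat.card {g : GL (Fin (2 * n + 1)) F // Squarefree ((g * tau g).val.charpoly)} =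
      Nat.card {g : GL (Unit ⊕ (Fin n ⊕ Fin n)) F // Squarefree (g.val * g.valᵀ⁻¹).charpoly} := by
    refine Nat.card_congr (E.toEquiv.subtypeEquiv fun g => ?_)
    have htau : (g * tau g).val = g.val * (g⁻¹).valᵀ := rfl
    have hEg : (E g).val * (E g).valᵀ⁻¹ = reindex e e (g * tau g).val := by
      rw [← transpose_nonsing_inv, ← coe_units_inv, ← map_inv, hE, hE, htau, transpose_reindex]
      exact (map_mul (reindexAlgEquiv F F e) _ _).symm
    change _ ↔ Squarefree ((E g).val * (E g).valᵀ⁻¹).charpoly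
    rw [hEg, charpoly_reindex]
  rw [hX, Nat.card_congr E.toEquiv]
  have h := card_mul_card_stabilizer F n
  rw [card_stabilizer, card_normalForms] at h
  have hpos : 0 < Nat.card (GL Unit F) := Nat.card_pos
  refine Nat.eq_of_mul_eq_mul_left hpos ?_
  linarith
end

section
/- Let q be a prime power and n ≥ 1. Then #{g ∈ GL(2n,F_q) : det(g·g^τ - 1) ≠ 0 and det(g·g^τ + 1) ≠ 0} · |Sp(2n,F_q)| = #{s ∈ Sp(2n,F_q) : det(s - 1) ≠ 0 and det(s + 1) ≠ 0} · |GL(2n,F_q)|; that is, the probability that g·g^τ has no eigenvalue ±1, for g uniformly random in GL(2n,F_q), equals the probability that a uniformly random element of Sp(2n,F_q) has no eigenvalue ±1. -/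
open Matrix Polynomial

namespace Matrix

section Darboux

variable {F V : Type*} [Field F] [AddCommGroup V] [Module F V] [FiniteDimensional F V]

/-- A nondegenerate alternating form on a space of dimension at least `2 * k` admits a hyperbolic
family of `k` pairs of vectors. -/
theorem exists_hyperbolic_family (B : V →ₗ[F] V →ₗ[F] F) (hB : B.IsAlt)
    (hnd : ∀ x ≠ 0, ∃ y, B x y ≠ 0) (k : ℕ) (hk : 2 * k ≤ Module.finrank F V) :
    ∃ a b : Fin k → V, (∀ i j, B (a i) (a j) = 0) ∧ (∀ i j, B (b i) (b j) = 0) ∧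
      ∀ i j, B (a i) (b j) = if i = j then -1 else 0 := by
  induction k with
  | zero => exact ⟨Fin.elim0, Fin.elim0, fun i => i.elim0, fun i => i.elim0, fun i => i.elim0⟩
  | succ k ih =>
    obtain ⟨a, b, haa, hbb, hab⟩ := ih (by omega)
    have hba : ∀ i j, B (b i) (a j) = if i = j then 1 else 0 := fun i j => by
      rw [← hB.neg (a j) (b i), hab]
      by_cases h : i = j <;> simp [h, eq_comm]
    let L : V →ₗ[F] (Fin k ⊕ Fin k → F) := LinearMap.pi fun i => B (Sum.elim a b i)
    obtain ⟨x, hxL, hx0⟩ := (Submodule.ne_bot_iff _).mp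
      (LinearMap.ker_ne_bot_of_finrank_lt (f := L) (by
        rw [Module.finrank_fintype_fun_eq_card, Fintype.card_sum, Fintype.card_fin]; omega))
    have hax : ∀ i, B (a i) x = 0 := fun i => congrFun hxL (Sum.inl i)
    have hbx : ∀ i, B (b i) x = 0 := fun i => congrFun hxL (Sum.inr i)
    have hxa : ∀ i, B x (a i) = 0 := fun i => by rw [← hB.neg, hax, neg_zero]
    have hxb : ∀ i, B x (b i) = 0 := fun i => by rw [← hB.neg, hbx, neg_zero]
    obtain ⟨z, hz⟩ := hnd x hx0
    let y₀ : V := (-(B x z)⁻¹) • z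
    have hxy₀ : B x y₀ = -1 := by simp [y₀, hz]
    let y : V := y₀ - ∑ j, (B (b j) y₀ • a j - B (a j) y₀ • b j)
    have hxy : B x y = -1 := by simp [y, hxy₀, hxa, hxb]
    have hay : ∀ i, B (a i) y = 0 := fun i => by simp [y, haa, hab]
    have hby : ∀ i, B (b i) y = 0 := fun i => by simp [y, hbb, hba]
    have hyb : ∀ i, B y (b i) = 0 := fun i => by rw [← hB.neg, hby, neg_zero]
    refine ⟨Fin.cons x a, Fin.cons y b, ?_, ?_, ?_⟩
    · simp [Fin.forall_fin_succ, hax, hxa, haa, hB.self_eq_zero]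
    · simp [Fin.forall_fin_succ, hby, hyb, hbb, hB.self_eq_zero]
    · simp [Fin.forall_fin_succ, hxy, hay, hxb, hab, Fin.succ_ne_zero, (Fin.succ_ne_zero _).symm]

end Darboux

variable {F : Type*} [Field F]

theorem dotProduct_sub_transpose_mulVec_self {m : Type*} [Fintype m] (g : Matrix m m F)
    (x : m → F) : x ⬝ᵥ (g - gᵀ) *ᵥ x = 0 := by
  rw [sub_mulVec, dotProduct_sub, mulVec_transpose, dotProduct_comm x (x ᵥ* g),
    ← dotProduct_mulVec, sub_self]

/-- Every invertible matrix of the form `g - gᵀ` is congruent to `J`. -/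
theorem exists_mul_J_mul_transpose_eq {n : ℕ} (g : Matrix (Fin n ⊕ Fin n) (Fin n ⊕ Fin n) F)
    (hg : (g - gᵀ).det ≠ 0) :
    ∃ p : Matrix (Fin n ⊕ Fin n) (Fin n ⊕ Fin n) F,
      p.det ≠ 0 ∧ p * J (Fin n) F * pᵀ = g - gᵀ := by
  set A := g - gᵀ with hA
  have hB : (Matrix.toLinearMap₂' F A).IsAlt := fun x => by
    rw [Matrix.toLinearMap₂'_apply']
    exact dotProduct_sub_transpose_mulVec_self g x
  obtain ⟨a, b, haa, hbb, hab⟩ := exists_hyperbolic_family (Matrix.toLinearMap₂' F A) hB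
    (fun x hx => by
      by_contra! h
      refine hx (Matrix.eq_zero_of_vecMul_eq_zero hg (dotProduct_eq_zero _ fun y => ?_))
      rw [← dotProduct_mulVec, ← Matrix.toLinearMap₂'_apply', h])
    n (by rw [Module.finrank_fintype_fun_eq_card, Fintype.card_sum, Fintype.card_fin, two_mul])
  have hba : ∀ i j, Matrix.toLinearMap₂' F A (b i) (a j) = if i = j then 1 else 0 := fun i j => by
    rw [← hB.neg (a j) (b i), hab]
    by_cases h : i = j <;> simp [h, eq_comm]
  let w : Matrix (Fin n ⊕ Fin n) (Fin n ⊕ Fin n) F := Matrix.of (Sum.elim a b)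
  have hw : w * A * wᵀ = J (Fin n) F := by
    ext i j
    have : (w * A * wᵀ) i j = Matrix.toLinearMap₂' F A (w i) (w j) := by
      rw [Matrix.toLinearMap₂'_apply', dotProduct_mulVec]
      rfl
    rw [this]
    rcases i with i | i <;> rcases j with j | j
    · exact (haa i j).trans (by simp [J])
    · refine (hab i j).trans ?_
      by_cases hij : i = j <;> simp [J, hij]
    · exact (hba i j).trans (by simp [J, Matrix.one_apply])
    · exact (hbb i j).trans (by simp [J])
  have hdet : IsUnit w.det := by
    have h := isUnit_det_J (Fin n) F
    rw [← hw, det_mul, det_mul] at h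
    exact isUnit_of_mul_isUnit_left (isUnit_of_mul_isUnit_left h)
  refine ⟨w⁻¹, (isUnit_nonsing_inv_det _ hdet).ne_zero, ?_⟩
  rw [← hw, transpose_nonsing_inv, Matrix.mul_assoc w, nonsing_inv_mul_cancel_left _ _ hdet,
    mul_nonsing_inv_cancel_right _ _ (by rwa [det_transpose])]

/-- Invertible matrices whose alternating and symmetric parts are both invertible. -/
abbrev NondegParts (m F : Type*) [Fintype m] [DecidableEq m] [Field F] : Type _ :=
  {g : Matrix m m F // g.det ≠ 0 ∧ (g - gᵀ).det ≠ 0 ∧ (g + gᵀ).det ≠ 0}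

section Reindex

variable {m k : Type*} [Fintype m] [DecidableEq m] [Fintype k] [DecidableEq k]

theorem card_nondegParts_congr (e : m ≃ k) :
    Nat.card (NondegParts m F) = Nat.card (NondegParts k F) := by
  refine Nat.card_congr ((Matrix.reindex e e).subtypeEquiv fun g => ?_)
  have h₁ : reindex e e g - (reindex e e g)ᵀ = reindex e e (g - gᵀ) := rfl
  have h₂ : reindex e e g + (reindex e e g)ᵀ = reindex e e (g + gᵀ) := rfl
  rw [h₁, h₂, det_reindex_self, det_reindex_self, det_reindex_self]

theorem card_GL_congr (e : m ≃ k) : Nat.card (GL m F) = Nat.card (GL k F) :=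
  Nat.card_congr (Units.mapEquiv (reindexAlgEquiv F F e).toMulEquiv).toEquiv

end Reindex

theorem congr_sub_transpose {m : Type*} [Fintype m] (p h : Matrix m m F) :
    p * h * pᵀ - (p * h * pᵀ)ᵀ = p * (h - hᵀ) * pᵀ := by
  simp only [transpose_mul, transpose_transpose, Matrix.mul_sub, Matrix.sub_mul, Matrix.mul_assoc]

/-- Symplectic matrices without eigenvalue `±1` correspond to invertible `h` with alternating part
`h - hᵀ = J` and invertible symmetric part, via `h ↦ hᵀ * h⁻¹`. -/
theorem card_symplectic_no_eigenvalue (l : Type*) [Fintype l] [DecidableEq l] :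
    Nat.card {h : Matrix (l ⊕ l) (l ⊕ l) F // h.det ≠ 0 ∧ h - hᵀ = J l F ∧ (h + hᵀ).det ≠ 0} =
    Nat.card {s : Matrix (l ⊕ l) (l ⊕ l) F //
        s ∈ symplecticGroup l F ∧ (s - 1).det ≠ 0 ∧ (s + 1).det ≠ 0} := by
  have hJ := isUnit_det_J l F
  refine Nat.card_congr (Equiv.ofBijective (fun h => ⟨h.1ᵀ * h.1⁻¹, ?_, ?_, ?_⟩) ⟨?_, ?_⟩)
  · obtain ⟨h, h0, h1, -⟩ := h
    have hu : IsUnit h.det := h0.isUnit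
    have hut : IsUnit hᵀ.det := by rwa [det_transpose]
    have key : hᵀ * h⁻¹ * h * (hᵀ * h⁻¹)ᵀ = h := by
      rw [nonsing_inv_mul_cancel_right _ _ hu, transpose_mul, transpose_nonsing_inv,
        transpose_transpose, mul_nonsing_inv_cancel_left _ _ hut]
    change hᵀ * h⁻¹ ∈ symplecticGroup l F
    rw [SymplecticGroup.mem_iff]
    conv_lhs => rw [← h1]
    rw [← congr_sub_transpose, key, h1]
  · obtain ⟨h, h0, h1, -⟩ := h
    have hu : IsUnit h.det := h0.isUnit
    have : hᵀ * h⁻¹ - 1 = -((h - hᵀ) * h⁻¹) := by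
      rw [Matrix.sub_mul, mul_nonsing_inv _ hu, neg_sub]
    rw [this, h1, det_neg, det_mul]
    exact mul_ne_zero (by simp) (mul_ne_zero hJ.ne_zero (isUnit_nonsing_inv_det _ hu).ne_zero)
  · obtain ⟨h, h0, -, h2⟩ := h
    have hu : IsUnit h.det := h0.isUnit
    have : hᵀ * h⁻¹ + 1 = (h + hᵀ) * h⁻¹ := by
      rw [Matrix.add_mul, mul_nonsing_inv _ hu, add_comm]
    rw [this, det_mul]
    exact mul_ne_zero h2 (isUnit_nonsing_inv_det _ hu).ne_zero
  · have aux : ∀ h : Matrix (l ⊕ l) (l ⊕ l) F, h.det ≠ 0 → h - hᵀ = J l F →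
        (1 - hᵀ * h⁻¹) * h = J l F := fun h h0 h1 => by
      rw [Matrix.sub_mul, Matrix.one_mul, nonsing_inv_mul_cancel_right _ _ h0.isUnit, h1]
    rintro ⟨h, h0, h1, h2⟩ ⟨h', h0', h1', h2'⟩ hst
    have hss : hᵀ * h⁻¹ = h'ᵀ * h'⁻¹ := congrArg Subtype.val hst
    have e := aux h h0 h1
    have e' := aux h' h0' h1'
    rw [← hss] at e'
    have hd : IsUnit (1 - hᵀ * h⁻¹).det := by
      rw [← e, det_mul] at hJ
      exact isUnit_of_mul_isUnit_left hJ
    have := congrArg ((1 - hᵀ * h⁻¹)⁻¹ * ·) (e.trans e'.symm)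
    simp only [nonsing_inv_mul_cancel_left _ _ hd] at this
    exact Subtype.ext this
  · rintro ⟨s, hs, hs1, hs2⟩
    rw [SymplecticGroup.mem_iff] at hs
    have hd : IsUnit (1 - s).det := by
      rw [← neg_sub, det_neg]
      exact (mul_ne_zero (by simp) hs1).isUnit
    have hdt : IsUnit (1 - s)ᵀ.det := by rwa [det_transpose]
    set h := (1 - s)⁻¹ * J l F with hh
    have hsh : (1 - s) * h = J l F := mul_nonsing_inv_cancel_left _ _ hd
    have hsht : hᵀ * (1 - s)ᵀ = -J l F := by rw [← transpose_mul, hsh, J_transpose]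
    have h0 : IsUnit h.det := by
      rw [hh, det_mul]
      exact (isUnit_nonsing_inv_det _ hd).mul hJ
    have h1 : h - hᵀ = J l F := by
      have : (1 - s) * (h - hᵀ) * (1 - s)ᵀ = (1 - s) * J l F * (1 - s)ᵀ := by
        rw [Matrix.mul_sub, Matrix.sub_mul, hsh, Matrix.mul_assoc (1 - s) hᵀ, hsht]
        simp only [transpose_sub, transpose_one, Matrix.mul_sub, Matrix.sub_mul, hs,
          Matrix.mul_one, Matrix.one_mul, Matrix.mul_neg]
        abel
      have := congrArg (fun x => (1 - s)⁻¹ * (x * ((1 - s)ᵀ)⁻¹)) this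
      simpa only [mul_nonsing_inv_cancel_right _ _ hdt, nonsing_inv_mul_cancel_left _ _ hd]
        using this
    have hsht' : hᵀ = s * h := by
      rw [← h1, Matrix.sub_mul, Matrix.one_mul] at hsh
      exact (sub_right_injective hsh).symm
    have hs' : hᵀ * h⁻¹ = s := by rw [hsht', mul_nonsing_inv_cancel_right _ _ h0]
    refine ⟨⟨h, h0.ne_zero, h1, ?_⟩, Subtype.ext hs'⟩
    have : h + hᵀ = (s + 1) * h := by rw [hsht', Matrix.add_mul, Matrix.one_mul, add_comm]
    rw [this, det_mul]
    exact mul_ne_zero hs2 h0.ne_zero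

theorem congr_add_transpose {m : Type*} [Fintype m] (p h : Matrix m m F) :
    p * h * pᵀ + (p * h * pᵀ)ᵀ = p * (h + hᵀ) * pᵀ := by
  simp only [transpose_mul, transpose_transpose, Matrix.mul_add, Matrix.add_mul, Matrix.mul_assoc]

theorem det_congr_ne_zero_iff {m : Type*} [Fintype m] [DecidableEq m] {p : Matrix m m F}
    (hp : p.det ≠ 0) (h : Matrix m m F) : (p * h * pᵀ).det ≠ 0 ↔ h.det ≠ 0 := by
  simp [hp]

/-- Double counting of pairs `(g, p)` with `p * J * pᵀ = g - gᵀ`. -/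
theorem card_nondegParts_mul_card_symplectic (n : ℕ) :
    Nat.card (NondegParts (Fin n ⊕ Fin n) F) * Nat.card (symplecticGroup (Fin n) F) =
    Nat.card {h : Matrix (Fin n ⊕ Fin n) (Fin n ⊕ Fin n) F //
        h.det ≠ 0 ∧ h - hᵀ = J (Fin n) F ∧ (h + hᵀ).det ≠ 0} *
      Nat.card (GL (Fin n ⊕ Fin n) F) := by
  rw [← Nat.card_prod, ← Nat.card_prod]
  have hJ := (isUnit_det_J (Fin n) F).ne_zero
  choose c hc hcJ using
    fun g : NondegParts (Fin n ⊕ Fin n) F => exists_mul_J_mul_transpose_eq g.1 g.2.2.1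
  symm
  have hpd : ∀ p : GL (Fin n ⊕ Fin n) F, p.val.det ≠ 0 :=
    fun p => ((isUnit_iff_isUnit_det _).mp p.isUnit).ne_zero
  let φ : {h : Matrix (Fin n ⊕ Fin n) (Fin n ⊕ Fin n) F //
      h.det ≠ 0 ∧ h - hᵀ = J (Fin n) F ∧ (h + hᵀ).det ≠ 0} × GL (Fin n ⊕ Fin n) F →
      NondegParts (Fin n ⊕ Fin n) F := fun x =>
    ⟨x.2.val * x.1.1 * x.2.valᵀ, by
      rw [congr_sub_transpose, congr_add_transpose, det_congr_ne_zero_iff (hpd x.2),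
        det_congr_ne_zero_iff (hpd x.2), det_congr_ne_zero_iff (hpd x.2), x.1.2.2.1]
      exact ⟨x.1.2.1, hJ, x.1.2.2.2⟩⟩
  have cancel : ∀ p : Matrix (Fin n ⊕ Fin n) (Fin n ⊕ Fin n) F, p.det ≠ 0 →
      ∀ x y, p * x * pᵀ = p * y * pᵀ → x = y := fun p hp x y hxy => by
    have hpt : IsUnit pᵀ.det := by rw [det_transpose]; exact hp.isUnit
    have := congrArg (fun x => p⁻¹ * (x * pᵀ⁻¹)) hxy
    simpa only [mul_nonsing_inv_cancel_right _ _ hpt, nonsing_inv_mul_cancel_left _ _ hp.isUnit]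
      using this
  refine Nat.card_congr (Equiv.ofBijective
    (fun x => (φ x, ⟨(c (φ x))⁻¹ * x.2.val, ?_⟩)) ⟨?_, ?_⟩)
  · rw [SymplecticGroup.mem_iff]
    refine cancel _ (hc (φ x)) _ _ ?_
    rw [hcJ, transpose_mul]
    have hct : c (φ x) * ((c (φ x))⁻¹ * x.2.val) = x.2.val :=
      mul_nonsing_inv_cancel_left _ _ (hc _).isUnit
    have : c (φ x) * ((c (φ x))⁻¹ * x.2.val * J (Fin n) F * (x.2.valᵀ * (c (φ x))⁻¹ᵀ)) * (c (φ x))ᵀ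
        = (c (φ x) * ((c (φ x))⁻¹ * x.2.val)) * J (Fin n) F *
          (c (φ x) * ((c (φ x))⁻¹ * x.2.val))ᵀ := by
      simp only [transpose_mul, Matrix.mul_assoc]
    rw [this, hct]
    refine Eq.trans ?_ (congr_sub_transpose _ _).symm
    rw [x.1.2.2.1]
  · rintro ⟨h, p⟩ ⟨h', p'⟩ hst
    obtain ⟨h1, h2⟩ := Prod.mk.inj hst
    have h2' := congrArg (c (φ (h, p)) * ·.val) h2
    simp only [← h1, mul_nonsing_inv_cancel_left _ _ (hc _).isUnit] at h2'
    obtain rfl : p = p' := Units.ext h2'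
    exact Prod.ext (Subtype.ext (cancel _ (hpd p) _ _ (congrArg Subtype.val h1))) rfl
  · rintro ⟨g, t, ht⟩
    have hp : (c g * t).det ≠ 0 := by
      rw [det_mul]
      exact mul_ne_zero (hc g) (SymplecticGroup.symplectic_det ht).ne_zero
    have hpt : IsUnit (c g * t)ᵀ.det := by rw [det_transpose]; exact hp.isUnit
    have hpJ : c g * t * J (Fin n) F * (c g * t)ᵀ = g.1 - g.1ᵀ := by
      rw [← hcJ g, transpose_mul, Matrix.mul_assoc (c g) t, Matrix.mul_assoc (c g),
        ← Matrix.mul_assoc (t * J (Fin n) F), SymplecticGroup.mem_iff.mp ht, Matrix.mul_assoc]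
    let p : GL (Fin n ⊕ Fin n) F := nonsingInvUnit (c g * t) hp.isUnit
    let h := (c g * t)⁻¹ * (g.1 * (c g * t)ᵀ⁻¹)
    have hg : (c g * t) * h * (c g * t)ᵀ = g.1 := by
      rw [mul_nonsing_inv_cancel_left _ _ hp.isUnit, nonsing_inv_mul_cancel_right _ _ hpt]
    have h0 : h.det ≠ 0 := by
      rw [← det_congr_ne_zero_iff hp, hg]
      exact g.2.1
    have h1 : h - hᵀ = J (Fin n) F := by
      refine cancel _ hp _ _ ?_
      rw [← congr_sub_transpose, hg, hpJ]
    have h2 : (h + hᵀ).det ≠ 0 := by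
      rw [← det_congr_ne_zero_iff hp, ← congr_add_transpose, hg]
      exact g.2.2.2
    have hφ : φ (⟨h, h0, h1, h2⟩, p) = g := Subtype.ext hg
    refine ⟨(⟨h, h0, h1, h2⟩, p), Prod.ext hφ (Subtype.ext ?_)⟩
    simp only [hφ]
    exact nonsing_inv_mul_cancel_left _ _ (hc g).isUnit

end Matrix

theorem card_GL_tau_eq_card_nondegParts {m : ℕ} {F : Type} [Field F] :
    Nat.card {g : GL (Fin m) F //
        ((g * tau g).val - 1).det ≠ 0 ∧ ((g * tau g).val + 1).det ≠ 0} =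
      Nat.card (NondegParts (Fin m) F) := by
  have key : ∀ g : GL (Fin m) F,
      (((g * tau g).val - 1).det ≠ 0 ∧ ((g * tau g).val + 1).det ≠ 0) ↔
        ((g.val - g.valᵀ).det ≠ 0 ∧ (g.val + g.valᵀ).det ≠ 0) := fun g => by
    have ht : g.valᵀ * (tau g).val = 1 := (tau g).inv_mul
    have hd : (tau g).val.det ≠ 0 := ((isUnit_iff_isUnit_det _).mp (tau g).isUnit).ne_zero
    have h₁ : (g * tau g).val - 1 = (g.val - g.valᵀ) * (tau g).val := by
      rw [Matrix.sub_mul, ht, Units.val_mul]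
    have h₂ : (g * tau g).val + 1 = (g.val + g.valᵀ) * (tau g).val := by
      rw [Matrix.add_mul, ht, Units.val_mul]
    rw [h₁, h₂, det_mul, det_mul, mul_ne_zero_iff_right hd, mul_ne_zero_iff_right hd]
  refine Nat.card_congr (Equiv.ofBijective (fun g => ⟨g.1.val,
    ((isUnit_iff_isUnit_det _).mp g.1.isUnit).ne_zero, (key g.1).mp g.2⟩) ⟨?_, ?_⟩)
  · exact fun g g' h => Subtype.ext (Units.ext (congrArg Subtype.val h))
  · exact fun g => ⟨⟨nonsingInvUnit g.1 g.2.1.isUnit, (key _).mpr g.2.2⟩, rfl⟩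

theorem stmt9 (q n : ℕ) (hq : IsPrimePow q) (hn : 1 ≤ n)
    (F : Type) [Field F] [Fintype F] (hF : Fintype.card F = q) :
    Nat.card {g : GL (Fin (2 * n)) F //
        ((g * tau g).val - 1).det ≠ 0 ∧ ((g * tau g).val + 1).det ≠ 0} *
      Nat.card (Matrix.symplecticGroup (Fin n) F) =
    Nat.card {s : Matrix (Fin n ⊕ Fin n) (Fin n ⊕ Fin n) F //
        s ∈ Matrix.symplecticGroup (Fin n) F ∧ (s - 1).det ≠ 0 ∧ (s + 1).det ≠ 0} *
      Nat.card (GL (Fin (2 * n)) F) := by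
  have e : Fin (2 * n) ≃ Fin n ⊕ Fin n := Fintype.equivOfCardEq (by simp [two_mul])
  rw [card_GL_tau_eq_card_nondegParts, card_nondegParts_congr e, card_GL_congr e,
    ← card_symplectic_no_eigenvalue, card_nondegParts_mul_card_symplectic]
end

section
/- Let q be a prime power, n ≥ 1, and let h ∈ GL(n,F_q) be such that the minimal polynomial of h is coprime to X² - 1 and h is conjugate to h⁻¹ in GL(n,F_q). Then n is even, and for every g ∈ GL(n,F_q) with g·g^τ = h one has #{x ∈ GL(n,F_q) : x·x^τ = h} · #{y ∈ GL(n,F_q) : y g yᵀ = g} = #{c ∈ GL(n,F_q) : c h = h c}; that is, the number of solutions x of x·x^τ = h equals the index |C_{GL(n,F_q)}(h) : O_g|, where O_g is the stabilizer of g under the congruence action. -/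
open Matrix Polynomial

theorem exists_pow_isIdempotentElem {M : Type*} [Monoid M] [Finite M] (a : M) :
    ∃ k : ℕ, k ≠ 0 ∧ IsIdempotentElem (a ^ k) := by
  obtain ⟨i, j, hij, h⟩ := Finite.exists_ne_map_eq_of_infinite fun k : ℕ => a ^ k
  wlog hlt : i < j generalizing i j
  · exact this j i hij.symm h.symm (by omega)
  obtain ⟨d, rfl⟩ := Nat.exists_eq_add_of_lt hlt
  have hd : ∀ m, a ^ (i + m * (d + 1)) = a ^ i := by
    intro m
    induction m with
    | zero => simp
    | succ m ih =>
      have : i + (m + 1) * (d + 1) = (i + d + 1) + m * (d + 1) := by ring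
      rw [this, pow_add, ← h, ← pow_add, ih]
  refine ⟨(i + 1) * (d + 1), by positivity, ?_⟩
  rw [IsIdempotentElem, ← pow_add, show (i + 1) * (d + 1) + (i + 1) * (d + 1) =
    (i * d + d + 1) + (i + (i + 1) * (d + 1)) by ring, pow_add, hd, ← pow_add]
  congr 1
  ring

/-- Hilbert 90 for an involution `σ` of a finite commutative ring such that some `w - σ w`
is a unit. -/
theorem exists_isUnit_mul_map_eq_self {R : Type*} [CommRing R] [Finite R]
    (σ : R →+* R) (hσ : ∀ x, σ (σ x) = x) (w : R) (hw : IsUnit (w - σ w))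
    (u : R) (hu : u * σ u = 1) : ∃ v : R, IsUnit v ∧ u * σ v = v := by
  obtain ⟨k, hk, he⟩ := exists_pow_isIdempotentElem (1 + u)
  have h1u : 1 + u = u * σ (1 + u) := by rw [map_add, map_one, mul_add, hu]; ring
  set e := (1 + u) ^ k with hedef
  have he1 : e = u ^ k * σ e := by rw [hedef, map_pow, ← mul_pow, ← h1u]
  have hse : σ e * σ e = σ e := by rw [← map_mul, he.eq]
  have h2 : e * σ e = e := by linear_combination (σ e - 1) * he1 + u ^ k * hse
  have h3 : σ e = e := by
    have := congrArg σ h2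
    rw [map_mul, hσ, mul_comm, h2] at this
    exact this.symm
  refine ⟨e + (1 - e) * w + u * σ (e + (1 - e) * w), ?_, ?_⟩
  · by_contra hv
    obtain ⟨m, hm, hvm⟩ := exists_max_ideal_of_mem_nonunits hv
    have hp := hm.isPrime
    have hsplit : e + (1 - e) * w + u * σ (e + (1 - e) * w) =
        e * (1 + u) + (1 - e) * (w + u * σ w) := by
      simp only [map_add, map_mul, map_sub, map_one, h3]; ring
    rw [hsplit] at hvm
    have hee : e * (1 - e) ∈ m := by
      rw [mul_sub, mul_one, he.eq, sub_self]; exact m.zero_mem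
    rcases hp.mem_or_mem hee with h | h
    · have ha : 1 + u ∈ m := hp.mem_of_pow_mem k h
      have : w - σ w ∈ m := by
        have e1 : w - σ w = (e * (1 + u) + (1 - e) * (w + u * σ w))
          - e * (1 + u - w - u * σ w) - (1 + u) * σ w := by ring
        rw [e1]
        exact m.sub_mem (m.sub_mem hvm (m.mul_mem_right _ h)) (m.mul_mem_right _ ha)
      exact hp.ne_top (m.eq_top_of_isUnit_mem this hw)
    · have ha : 1 + u ∈ m := by
        have e1 : 1 + u = (e * (1 + u) + (1 - e) * (w + u * σ w))
          - (1 - e) * (w + u * σ w - (1 + u)) := by ring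
        rw [e1]
        exact m.sub_mem hvm (m.mul_mem_right _ h)
      have h1 : e ∈ m := m.pow_mem_of_mem ha k (Nat.pos_of_ne_zero hk)
      apply hp.one_notMem
      simpa using m.add_mem h1 h
  · rw [map_add, map_mul, hσ]
    linear_combination (e + (1 - e) * w) * hu

/-- Norms are surjective onto the fixed units of an involution `σ` of a finite commutative ring
such that some `w - σ w` is a unit. -/
theorem exists_mul_map_eq_of_map_eq {R : Type*} [CommRing R] [Finite R]
    (σ : R →+* R) (hσ : ∀ x, σ (σ x) = x) (w : R) (hw : IsUnit (w - σ w))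
    (c : R) (hc : IsUnit c) (hσc : σ c = c) : ∃ a : R, a * σ a = c := by
  let s : Rˣ →* Rˣ := Units.map (σ : R →* R)
  let φ : Rˣ →* Rˣ := MonoidHom.id _ / s
  let ψ : Rˣ →* Rˣ := MonoidHom.id _ * s
  have hφ : ∀ v, φ v = v / s v := fun _ => rfl
  have hψ : ∀ v, ψ v = v * s v := fun _ => rfl
  have hss : ∀ v, s (s v) = v := fun v => Units.ext (hσ v)
  have h1 : ψ.ker ≤ φ.range := by
    intro u hu
    rw [MonoidHom.mem_ker, hψ] at hu
    obtain ⟨v, hv, huv⟩ := exists_isUnit_mul_map_eq_self σ hσ w hw u (congrArg Units.val hu)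
    lift v to Rˣ using hv
    refine ⟨v, ?_⟩
    rw [hφ, div_eq_iff_eq_mul]
    exact Units.ext huv.symm
  have h2 : ψ.range ≤ φ.ker := by
    rintro _ ⟨v, rfl⟩
    rw [MonoidHom.mem_ker, hφ, hψ, map_mul, hss, div_eq_one, mul_comm]
  have c1 := ψ.ker.card_mul_index
  have c2 := φ.ker.card_mul_index
  rw [Subgroup.index_ker] at c1 c2
  have h3 : Nat.card ψ.ker ≤ Nat.card φ.range := Subgroup.card_le_of_le h1
  have h4 : Nat.card φ.ker ≤ Nat.card ψ.range := by
    have hpos : 0 < Nat.card φ.range := Nat.card_pos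
    refine Nat.le_of_mul_le_mul_right ?_ hpos
    rw [c2, ← c1, mul_comm]
    exact Nat.mul_le_mul_left _ h3
  have h5 : ψ.range = φ.ker := Subgroup.eq_of_le_of_card_ge h2 h4
  lift c to Rˣ using hc
  have : c ∈ ψ.range := by
    rw [h5, MonoidHom.mem_ker, hφ, div_eq_one]
    exact Units.ext hσc.symm
  obtain ⟨a, ha⟩ := this
  exact ⟨a, congrArg Units.val ha⟩

/-- Let `σ` be a linear map reversing products on a finite algebra, involutive on `w`, where `w`
commutes with `σ w` and `w - σ w` is a unit. Then every `σ`-fixed unit `c` commuting with `w` and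
`σ w` has the form `a * σ a` with `a` in the subalgebra generated by `w`, `σ w` and `c`. -/
theorem exists_mul_antiinvolution_eq {F A : Type*} [Field F] [Ring A] [Algebra F A] [Finite A]
    (σ : A →ₗ[F] A) (σ_one : σ 1 = 1) (σ_mul : ∀ x y, σ (x * y) = σ y * σ x)
    (w c : A) (hww : Commute w (σ w)) (hσw : σ (σ w) = w)
    (hcw : Commute c w) (hcw' : Commute c (σ w))
    (hd : IsUnit (w - σ w)) (hc : IsUnit c) (hσc : σ c = c) :
    ∃ a ∈ Algebra.adjoin F {w, σ w, c}, a * σ a = c := by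
  set S := Algebra.adjoin F {w, σ w, c}
  have hcomm : ∀ x ∈ ({w, σ w, c} : Set A), ∀ y ∈ ({w, σ w, c} : Set A), x * y = y * x := by
    rintro x (rfl | rfl | rfl) y (rfl | rfl | rfl)
    exacts [rfl, hww, hcw.symm, hww.symm, rfl, hcw'.symm, hcw, hcw', rfl]
  let _ : CommRing S :=
    { (inferInstance : Ring S) with
      mul_comm := (Algebra.isMulCommutative_adjoin F hcomm).is_comm.comm }
  have hgen : ∀ x ∈ S, σ x ∈ S ∧ σ (σ x) = x := by
    intro x hx
    induction hx using Algebra.adjoin_induction with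
    | mem x hx =>
      rcases hx with rfl | rfl | rfl
      · exact ⟨Algebra.subset_adjoin (by simp), hσw⟩
      · rw [hσw]; exact ⟨Algebra.subset_adjoin (by simp), rfl⟩
      · rw [hσc]; exact ⟨Algebra.subset_adjoin (by simp), hσc⟩
    | algebraMap r =>
      have : σ (algebraMap F A r) = algebraMap F A r := by
        rw [Algebra.algebraMap_eq_smul_one, map_smul, σ_one]
      rw [this]; exact ⟨S.algebraMap_mem r, this⟩
    | add x y _ _ hx hy =>
      simp only [map_add]; exact ⟨S.add_mem hx.1 hy.1, by rw [hx.2, hy.2]⟩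
    | mul x y _ _ hx hy =>
      simp only [σ_mul]; exact ⟨S.mul_mem hy.1 hx.1, by rw [hx.2, hy.2]⟩
  let τ : S →+* S :=
    { toFun := fun x => ⟨σ x, (hgen x x.2).1⟩
      map_one' := Subtype.ext σ_one
      map_zero' := Subtype.ext (map_zero σ)
      map_add' := fun x y => Subtype.ext (map_add σ x.1 y.1)
      map_mul' := fun x y => by
        rw [mul_comm]
        exact Subtype.ext (σ_mul y.1 x.1) }
  have unit_of : ∀ x : S, IsUnit x.1 → IsUnit x := by
    intro x hx
    have inj : Function.Injective fun y : S => x * y := by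
      intro y z hyz
      exact Subtype.ext (hx.mul_left_cancel (congrArg Subtype.val hyz))
    obtain ⟨y, hy⟩ := Finite.surjective_of_injective inj 1
    exact IsUnit.of_mul_eq_one y hy
  have hwS : w ∈ S := Algebra.subset_adjoin (by simp)
  have hcS : c ∈ S := Algebra.subset_adjoin (by simp)
  obtain ⟨a, ha⟩ := exists_mul_map_eq_of_map_eq τ (fun x => Subtype.ext (hgen x x.2).2)
    ⟨w, hwS⟩ (unit_of _ hd) ⟨c, hcS⟩ (unit_of _ hc) (Subtype.ext hσc)
  exact ⟨a, a.2, congrArg Subtype.val ha⟩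

theorem isUnit_sq_sub_one_of_isCoprime_minpoly {n : ℕ} {F : Type} [Field F] (M : Matrix (Fin n) (Fin n) F)
    (hmin : IsCoprime (minpoly F M) (X ^ 2 - 1)) : IsUnit (M ^ 2 - 1) := by
  obtain ⟨a, b, hab⟩ := hmin
  have := congrArg (aeval M) hab
  simp only [map_add, map_mul, minpoly.aeval, mul_zero, zero_add, map_sub, map_pow, aeval_X,
    map_one] at this
  exact IsUnit.of_mul_eq_one_right _ this

theorem even_of_charpoly_inv_eq {n : ℕ} {F : Type} [Field F] (M : Matrix (Fin n) (Fin n) F)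
    (hM : IsUnit M) (hM2 : IsUnit (M ^ 2 - 1)) (hinv : M⁻¹.charpoly = M.charpoly) : Even n := by
  have hfac : M ^ 2 - 1 = (1 - M) * (-1 - M) := by noncomm_ring
  have hdet : M.charpoly.eval 1 ≠ 0 ∧ M.charpoly.eval (-1) ≠ 0 := by
    rw [hfac, Matrix.isUnit_iff_isUnit_det, det_mul, isUnit_iff_ne_zero] at hM2
    rw [Matrix.eval_charpoly, Matrix.eval_charpoly]
    simpa [-map_neg, -scalar_apply, map_neg (scalar (Fin n)) (1 : F)] using hM2
  by_contra hodd
  rw [Nat.not_even_iff_odd] at hodd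
  rw [Matrix.charpoly_inv _ hM, ← Matrix.reverse_charpoly] at hinv
  set p := M.charpoly with hp
  have hdeg : p.natDegree = n := by simp [hp]
  obtain ⟨u, hu⟩ : ∃ u : F, p = C u * p.reverse := by
    refine ⟨(-1) ^ Fintype.card (Fin n) * Ring.inverse M.det, ?_⟩
    conv_lhs => rw [← hinv]
    simp
  have hcoeff : ∀ i ≤ n, p.coeff i = u * p.coeff (n - i) := by
    intro i hi
    conv_lhs => rw [hu]
    rw [coeff_C_mul, coeff_reverse, hdeg, revAt_le hi]
  have hu1 : u = 1 := by
    have h1 : p.eval 1 = u * p.eval 1 := by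
      simp only [eval_eq_sum_range, hdeg, one_pow, mul_one]
      conv_rhs => rw [← Finset.sum_range_reflect, Finset.mul_sum]
      refine Finset.sum_congr rfl fun i hi => ?_
      rw [hcoeff i (by simpa [Nat.lt_succ_iff] using hi)]
      congr 2
    exact (mul_eq_right₀ hdet.1).mp h1.symm
  apply hdet.2
  rw [eval_eq_sum_range, hdeg]
  refine Finset.sum_involution (fun i _ => n - i) ?_ ?_ ?_ ?_
  · intro i hi
    have hi' : i ≤ n := by simpa [Nat.lt_succ_iff] using hi
    rw [hcoeff i hi', hu1, one_mul, ← mul_add]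
    have : (-1 : F) ^ i + (-1) ^ (n - i) = 0 := by
      rcases Nat.even_or_odd i with h | h
      · rw [h.neg_one_pow, (Nat.Odd.sub_even hi' hodd h).neg_one_pow]; ring
      · rw [h.neg_one_pow, (Nat.Odd.sub_odd hodd h).neg_one_pow]; ring
    rw [this, mul_zero]
  · intro i hi _ h
    have hi' : i ≤ n := by simpa [Nat.lt_succ_iff] using hi
    obtain ⟨k, rfl⟩ := hodd
    omega
  · intro i hi
    simp only [Finset.mem_range]; omega
  · intro i hi
    simp only [Finset.mem_range] at hi; omega

theorem tau_mul {n : ℕ} {F : Type} [Field F] (x y : GL (Fin n) F) :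
    tau (x * y) = tau x * tau y := by
  refine Units.ext ?_
  change ((x * y)⁻¹).valᵀ = x⁻¹.valᵀ * y⁻¹.valᵀ
  rw [_root_.mul_inv_rev, Units.val_mul, transpose_mul]

theorem tau_inv {n : ℕ} {F : Type} [Field F] (x : GL (Fin n) F) : tau x⁻¹ = (tau x)⁻¹ :=
  Units.ext rfl

theorem tau_tau {n : ℕ} {F : Type} [Field F] (x : GL (Fin n) F) : tau (tau x) = x :=
  Units.ext (transpose_transpose x.val)

theorem tau_eq_of_mul_tau_eq {n : ℕ} {F : Type} [Field F] {h g : GL (Fin n) F}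
    (hg : g * tau g = h) : tau h = g⁻¹ * h * g := by
  subst hg
  rw [tau_mul, tau_tau]
  group

theorem congr_mul_tau {n : ℕ} {F : Type} [Field F] {h g a : GL (Fin n) F}
    (hg : g * tau g = h) (ha : a * h = h * a) :
    a * g * (tau a)⁻¹ * tau (a * g * (tau a)⁻¹) = h := by
  rw [tau_mul, tau_mul, tau_inv, tau_tau, eq_comm, ← mul_inv_eq_iff_eq_mul.mpr ha, ← hg]
  group

theorem commute_of_congr_eq {n : ℕ} {F : Type} [Field F] {h g y : GL (Fin n) F}
    (hg : g * tau g = h) (hy : y * g * (tau y)⁻¹ = g) : y * h = h * y := by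
  have h1 : tau g = tau y * tau g * y⁻¹ := by
    conv_lhs => rw [← hy]
    rw [tau_mul, tau_mul, tau_inv, tau_tau]
  have h2 : g * tau g = y * (g * tau g) * y⁻¹ := by
    calc g * tau g = y * g * (tau y)⁻¹ * (tau y * tau g * y⁻¹) := by rw [hy, ← h1]
      _ = _ := by group
  rw [hg] at h2
  exact (eq_mul_inv_iff_mul_eq.mp h2).symm

/-- If `h ^ 2 - 1` is invertible, the centralizer of `h` acts transitively by congruence on the
solutions of `x * tau x = h`. -/
theorem exists_commute_congr_eq {n : ℕ} {F : Type} [Field F] [Finite F] {h g x : GL (Fin n) F}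
    (hunit : IsUnit (h.val ^ 2 - 1)) (hg : g * tau g = h) (hx : x * tau x = h) :
    ∃ a : GL (Fin n) F, a * h = h * a ∧ a * g * (tau a)⁻¹ = x := by
  let σ : Matrix (Fin n) (Fin n) F →ₗ[F] Matrix (Fin n) (Fin n) F :=
    { toFun := fun m => g.val * mᵀ * g⁻¹.val
      map_add' := fun m m' => by rw [transpose_add, mul_add, add_mul]
      map_smul' := fun r m => by simp }
  have σ_def : ∀ m, σ m = g.val * mᵀ * g⁻¹.val := fun _ => rfl
  have σ_val : ∀ m : GL (Fin n) F, σ m.val = (g * (tau m)⁻¹ * g⁻¹).val := fun _ => rfl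
  have σh : σ h.val = h⁻¹.val := by
    rw [σ_val, tau_eq_of_mul_tau_eq hg]
    congr 1
    group
  have σh' : σ h⁻¹.val = h.val := by
    rw [σ_val, tau_inv, tau_eq_of_mul_tau_eq hg]
    congr 1
    group
  have hc : x * g⁻¹ * h = h * (x * g⁻¹) := by
    have h1 := tau_eq_of_mul_tau_eq hg
    rw [tau_eq_of_mul_tau_eq hx] at h1
    have h2 : h = x * (x⁻¹ * h * x) * x⁻¹ := by group
    conv_rhs => rw [h2, h1]
    group
  have σc : σ (x * g⁻¹).val = (x * g⁻¹).val := by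
    rw [σ_val]
    congr 1
    have h1 : x = g * tau g * (tau x)⁻¹ := by rw [hg, ← hx]; group
    conv_rhs => rw [h1]
    rw [tau_mul, tau_inv]
    group
  have hd : IsUnit (h.val - σ h.val) := by
    have : h.val - σ h.val = h⁻¹.val * (h.val ^ 2 - 1) := by
      rw [σh, mul_sub, mul_one, pow_two, Units.inv_mul_cancel_left]
    rw [this]
    exact (h⁻¹).isUnit.mul hunit
  obtain ⟨a, haS, ha⟩ := exists_mul_antiinvolution_eq σ
    (by rw [σ_def, transpose_one, mul_one, ← Units.val_mul, mul_inv_cancel, Units.val_one])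
    (fun m m' => by
      rw [σ_def, σ_def, σ_def, transpose_mul]
      simp only [mul_assoc, Units.inv_mul_cancel_left])
    h.val (x * g⁻¹).val
    (by rw [σh]; exact ((Commute.refl h).inv_right).map (Units.coeHom _))
    (by rw [σh, σh'])
    ((show Commute (x * g⁻¹) h from hc).map (Units.coeHom _))
    (by rw [σh]; exact ((show Commute (x * g⁻¹) h from hc).inv_right).map (Units.coeHom _))
    hd (x * g⁻¹).isUnit σc
  have hau : IsUnit a := by
    have h1 : a * (σ a * (x * g⁻¹)⁻¹.val) = 1 := by
      rw [← mul_assoc, ha, ← Units.val_mul, mul_inv_cancel, Units.val_one]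
    exact IsUnit.of_mul_eq_one _ h1
  have hah : a * h.val = h.val * a := by
    refine (Algebra.adjoin_le (S := Subalgebra.centralizer F {h.val}) ?_ haS h.val rfl).symm
    rintro y (rfl | rfl | rfl) z rfl
    · rfl
    · rw [σh, ← Units.val_mul, ← Units.val_mul, mul_inv_cancel, inv_mul_cancel]
    · exact (congrArg Units.val hc).symm
  lift a to GL (Fin n) F using hau
  refine ⟨a, Units.ext hah, ?_⟩
  have h1 : a * (g * (tau a)⁻¹ * g⁻¹) = x * g⁻¹ := Units.ext ha
  rw [← mul_assoc, mul_left_inj, ← mul_assoc] at h1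
  exact h1

theorem card_mul_card_eq_card_centralizer {n : ℕ} {F : Type} [Field F] [Finite F]
    {h g : GL (Fin n) F} (hunit : IsUnit (h.val ^ 2 - 1)) (hg : g * tau g = h) :
    Nat.card {x : GL (Fin n) F // x * tau x = h} *
        Nat.card {y : GL (Fin n) F // y.val * g.val * y.valᵀ = g.val} =
      Nat.card {c : GL (Fin n) F // c * h = h * c} := by
  have hstab : ∀ y : GL (Fin n) F, y.val * g.val * y.valᵀ = g.val ↔ y * g * (tau y)⁻¹ = g :=
    fun y => (Units.ext_iff (u := y * g * (tau y)⁻¹) (v := g)).symm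
  simp only [hstab]
  choose s hs hsg using fun x : {x : GL (Fin n) F // x * tau x = h} =>
    exists_commute_congr_eq hunit hg x.2
  rw [← Nat.card_prod]
  refine Nat.card_congr (Equiv.ofBijective
    (fun p => ⟨s p.1 * p.2.1, ?_⟩) ⟨?_, ?_⟩)
  · rw [mul_assoc, commute_of_congr_eq hg p.2.2, ← mul_assoc, hs, mul_assoc]
  · rintro ⟨x, y, hy⟩ ⟨x', y', hy'⟩ heq
    have heq : s x * y = s x' * y' := congrArg Subtype.val heq
    have key : ∀ x y, y * g * (tau y)⁻¹ = g → s x * y * g * (tau (s x * y))⁻¹ = x.1 := by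
      intro x y hy
      rw [← hsg x, tau_mul]
      conv_rhs => rw [← hy]
      group
    have hxx : x = x' := by
      refine Subtype.ext ?_
      rw [← key x y hy, ← key x' y' hy', heq]
    subst hxx
    have := mul_left_cancel heq
    subst this
    rfl
  · rintro ⟨c, hc⟩
    let x : {x : GL (Fin n) F // x * tau x = h} := ⟨_, congr_mul_tau hg hc⟩
    refine ⟨⟨x, (s x)⁻¹ * c, ?_⟩, Subtype.ext (mul_inv_cancel_left _ _)⟩
    have h1 : s x * g * (tau (s x))⁻¹ = c * g * (tau c)⁻¹ := hsg x
    have h2 : (s x)⁻¹ * c * g * (tau ((s x)⁻¹ * c))⁻¹ =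
        (s x)⁻¹ * (c * g * (tau c)⁻¹) * tau (s x) := by
      rw [tau_mul, tau_inv]
      group
    rw [h2, ← h1]
    group

theorem stmt10 (q n : ℕ) (hq : IsPrimePow q) (hn : 1 ≤ n)
    (F : Type) [Field F] [Fintype F] (hF : Fintype.card F = q)
    (h : GL (Fin n) F)
    (hmin : IsCoprime (minpoly F h.val) (Polynomial.X ^ 2 - 1))
    (hreal : ∃ c : GL (Fin n) F, c * h * c⁻¹ = h⁻¹) :
    Even n ∧ ∀ g : GL (Fin n) F, g * tau g = h →
      Nat.card {x : GL (Fin n) F // x * tau x = h} *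
        Nat.card {y : GL (Fin n) F // y.val * g.val * y.valᵀ = g.val} =
      Nat.card {c : GL (Fin n) F // c * h = h * c} := by
  have hunit := isUnit_sq_sub_one_of_isCoprime_minpoly h.val hmin
  refine ⟨even_of_charpoly_inv_eq h.val h.isUnit hunit ?_,
    fun g hg => card_mul_card_eq_card_centralizer hunit hg⟩
  obtain ⟨c, hc⟩ := hreal
  rw [← Matrix.coe_units_inv, ← hc, Units.val_mul, Units.val_mul, Matrix.coe_units_inv c,
    Matrix.charpoly_units_conj]
end
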